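/- For every sequence λ = (λ_{IJ}), the X-norm is dominated by the operator norm of the associated pointwise matrix operator: ‖λ‖_X ≤ ‖M_λ‖, where ‖M_λ‖ is the norm of M_λ on ℓ²_ℤ(L²(ℝ²)). -/

import Mathlib

open MeasureTheory
open scoped ENNReal

noncomputable section

/-- A sequence `λ = (λ_{IJ})` indexed by pairs of dyadic intervals; a dyadic interval
`[2^{-i}k, 2^{-i}(k+1))` is encoded by the pair `(i, k) : ℤ × ℤ`. -/
abbrev ParaSeq := (ℤ × ℤ) → (ℤ × ℤ) → ℝ

/-- The dyadic interval `[2^{-i} k, 2^{-i}(k+1))` encoded by the pair `p = (i, k) : ℤ × ℤ`. -/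
def dyadic (p : ℤ × ℤ) : Set ℝ := Set.Ico ((2:ℝ) ^ (-p.1) * p.2) ((2:ℝ) ^ (-p.1) * (p.2 + 1))

/-- The length `|I| = 2^{-i}` of the dyadic interval encoded by `p = (i, k)`. -/
def dlen (p : ℤ × ℤ) : ℝ := (2:ℝ) ^ (-p.1)

/-- The average `⟨f⟩_I = |I|⁻¹ ∫_I f`. -/
def avg (f : ℝ → ℝ) (p : ℤ × ℤ) : ℝ := (dlen p)⁻¹ * ∫ x in dyadic p, f x

/-- Admissible families `(u_I)_{I ∈ D}` of `L²(ℝ)` functions: only finitely many nonzero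
members and `Σ_I ‖u_I‖₂² = 1`. -/
def Adm : Set ((ℤ × ℤ) → ℝ → ℝ) :=
  {u | (∀ p, MemLp (u p) 2 volume) ∧ {p | u p ≠ 0}.Finite ∧ (∑' p : ℤ × ℤ, ∫ x, (u p x) ^ 2) = 1}

/-- The bilinear sum `Σ_{I,J} λ_{IJ} ⟨g_J⟩_I ⟨u_I⟩_J`. -/
def pairSum (lam : ParaSeq) (u g : (ℤ × ℤ) → ℝ → ℝ) : ℝ :=
  ∑' pq : (ℤ × ℤ) × (ℤ × ℤ), lam pq.1 pq.2 * avg (g pq.2) pq.1 * avg (u pq.1) pq.2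

/-- The norm `‖λ‖_X`, as an element of `[0, ∞]`. -/
def Xnorm (lam : ParaSeq) : ℝ≥0∞ :=
  ⨆ (u : Adm) (g : Adm), ENNReal.ofReal |pairSum lam u.1 g.1|

/-- The norm `‖λ‖_{X'}`, as an element of `[0, ∞]`. -/
def Xprime (lam : ParaSeq) : ℝ≥0∞ :=
  ⨆ (u : Adm) (g : Adm),
    ENNReal.ofReal
      (∑' pq : (ℤ × ℤ) × (ℤ × ℤ), |lam pq.1 pq.2 * avg (g.1 pq.2) pq.1 * avg (u.1 pq.1) pq.2|)

/-- `I_i(x)`: (the encoding of) the unique dyadic interval of length `2^{-i}` containing `x`. -/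
def Iat (i : ℤ) (x : ℝ) : ℤ × ℤ := (i, ⌊(2:ℝ) ^ i * x⌋)

/-- The matrix entries `M_λ^{ij}(x,y) = 2^{(i+j)/2} λ_{I_i(x) I_j(y)}`. -/
def Ment (lam : ParaSeq) (i j : ℤ) (z : ℝ × ℝ) : ℝ :=
  (2:ℝ) ^ (((i : ℝ) + (j : ℝ)) / 2) * lam (Iat i z.1) (Iat j z.2)

/-- `(M_λ a)_j(x,y) = Σ_i M_λ^{ij}(x,y) a_i(x,y)`. -/
def Mapply (lam : ParaSeq) (a : ℤ → ℝ × ℝ → ℝ) (j : ℤ) (z : ℝ × ℝ) : ℝ :=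
  ∑' i : ℤ, Ment lam i j z * a i z

/-- The unit ball of `ℓ²_ℤ(L²(ℝ²))` (measurable representatives). -/
def Mball : Set (ℤ → ℝ × ℝ → ℝ) :=
  {a | (∀ i, Measurable (a i)) ∧ (∑' i : ℤ, ∫⁻ z : ℝ × ℝ, ENNReal.ofReal ((a i z) ^ 2)) ≤ 1}

/-- The operator norm `‖M_λ‖` of `M_λ` on `ℓ²_ℤ(L²(ℝ²))`, as an element of `[0, ∞]`. -/
def MopNorm (lam : ParaSeq) : ℝ≥0∞ :=
  ⨆ a : Mball,
    (∑' j : ℤ, ∫⁻ z : ℝ × ℝ, ENNReal.ofReal ((Mapply lam a.1 j z) ^ 2)) ^ (1/2 : ℝ)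

section Dyadic

lemma mem_dyadic_iff (p : ℤ × ℤ) (x : ℝ) : x ∈ dyadic p ↔ Iat p.1 x = p := by
  obtain ⟨i, k⟩ := p
  have h : (0 : ℝ) < 2 ^ i := zpow_pos two_pos _
  simp only [dyadic, Iat, Set.mem_Ico, Prod.mk.injEq, true_and, Int.floor_eq_iff, zpow_neg,
    inv_mul_le_iff₀ h, lt_inv_mul_iff₀ h]

lemma measurableSet_dyadic (p : ℤ × ℤ) : MeasurableSet (dyadic p) := measurableSet_Ico

lemma volume_dyadic (p : ℤ × ℤ) : volume (dyadic p) = ENNReal.ofReal (dlen p) := by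
  rw [dyadic, Real.volume_Ico, dlen]
  congr 1
  ring

lemma measurable_Iat (i : ℤ) : Measurable (Iat i) := by
  unfold Iat
  fun_prop

/-- A function of the dyadic interval of generation `i` containing `x` integrates to the sum of
its values weighted by the lengths. -/
lemma lintegral_comp_Iat (i : ℤ) (h : ℤ × ℤ → ℝ≥0∞) :
    ∫⁻ x, h (Iat i x) = ∑' k : ℤ, h (i, k) * ENNReal.ofReal (dlen (i, k)) := by
  have hm : Measurable fun x : ℝ => ⌊(2:ℝ) ^ i * x⌋ := by fun_prop
  have := lintegral_map (μ := volume) (f := fun k : ℤ => h (i, k)) (measurable_of_countable _) hm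
  simp only [Iat]
  rw [← this, lintegral_countable']
  refine tsum_congr fun k => ?_
  rw [Measure.map_apply hm (measurableSet_singleton k), ← volume_dyadic]
  congr 2
  ext x
  simp [mem_dyadic_iff, Iat]

lemma avg_congr {f g : ℝ → ℝ} (h : f =ᵐ[volume] g) (p : ℤ × ℤ) : avg f p = avg g p := by
  rw [avg, avg, integral_congr_ae (ae_restrict_of_ae h)]

end Dyadic

/-- The sequence of functions `(x, y) ↦ 2^{i/2} u_{I_i(x)}(y)` on the plane. -/
def planeLift (u : ℤ × ℤ → ℝ → ℝ) (i : ℤ) (z : ℝ × ℝ) : ℝ :=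
  (2:ℝ) ^ ((i : ℝ) / 2) * u (Iat i z.1) z.2

section PlaneLift

variable {u g : ℤ × ℤ → ℝ → ℝ}

lemma measurable_planeLift (hu : ∀ p, Measurable (u p)) (i : ℤ) : Measurable (planeLift u i) := by
  have h : Measurable fun w : (ℤ × ℤ) × ℝ => u w.1 w.2 :=
    measurable_from_prod_countable_right hu
  exact (h.comp (((measurable_Iat i).comp measurable_fst).prodMk measurable_snd)).const_mul _

lemma tsum_lintegral_planeLift (hu : ∀ p, Measurable (u p)) :
    ∑' i : ℤ, ∫⁻ z : ℝ × ℝ, ENNReal.ofReal (planeLift u i z ^ 2) =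
      ∑' p : ℤ × ℤ, ∫⁻ x, ENNReal.ofReal (u p x ^ 2) := by
  rw [ENNReal.tsum_prod']
  refine tsum_congr fun i => ?_
  have hsq : ((2:ℝ) ^ ((i : ℝ) / 2)) ^ 2 = 2 ^ i := by
    rw [← Real.rpow_natCast, ← Real.rpow_mul two_pos.le, ← Real.rpow_intCast]
    congr 1
    push_cast
    ring
  have hpos : (0 : ℝ) < 2 ^ i := zpow_pos two_pos _
  rw [Measure.volume_eq_prod, lintegral_prod _
    ((measurable_planeLift hu i).pow_const 2).ennreal_ofReal.aemeasurable]
  simp only [planeLift, mul_pow, hsq, ENNReal.ofReal_mul hpos.le]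
  rw [lintegral_comp_Iat i fun p => ∫⁻ y, ENNReal.ofReal (2 ^ i) * ENNReal.ofReal (u p y ^ 2)]
  refine tsum_congr fun k => ?_
  rw [lintegral_const_mul _ ((hu _).pow_const 2).ennreal_ofReal, mul_right_comm,
    ← ENNReal.ofReal_mul hpos.le, dlen, zpow_neg, mul_inv_cancel₀ hpos.ne', ENNReal.ofReal_one,
    one_mul]

lemma tsum_lintegral_planeLift_swap (u : ℤ × ℤ → ℝ → ℝ) :
    ∑' i : ℤ, ∫⁻ z : ℝ × ℝ, ENNReal.ofReal (planeLift u i z.swap ^ 2) =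
      ∑' i : ℤ, ∫⁻ z : ℝ × ℝ, ENNReal.ofReal (planeLift u i z ^ 2) :=
  tsum_congr fun i => by
    rw [Measure.volume_eq_prod]
    exact lintegral_prod_swap fun z => ENNReal.ofReal (planeLift u i z ^ 2)

lemma measurable_Ment (lam : ParaSeq) (i j : ℤ) : Measurable (Ment lam i j) := by
  have h : Measurable fun w : (ℤ × ℤ) × (ℤ × ℤ) => lam w.1 w.2 := measurable_of_countable _
  exact (h.comp (((measurable_Iat i).comp measurable_fst).prodMk
    ((measurable_Iat j).comp measurable_snd))).const_mul _

lemma Mapply_planeLift_eq_sum (lam : ParaSeq) {A B : Finset ℤ}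
    (hu : ∀ p ∉ A ×ˢ B, u p = 0) (j : ℤ) (z : ℝ × ℝ) :
    Mapply lam (planeLift u) j z = ∑ i ∈ A, Ment lam i j z * planeLift u i z := by
  refine tsum_eq_sum fun i hi => ?_
  rw [planeLift, hu (Iat i z.1) (by simp [Iat, hi])]
  simp

/-- Summing over all intervals of given generations only sees the ones containing the points. -/
lemma sum_Mapply_mul_planeLift (lam : ParaSeq) {A B : Finset ℤ}
    (hu : ∀ p ∉ A ×ˢ B, u p = 0) (hg : ∀ p ∉ A ×ˢ B, g p = 0) (z : ℝ × ℝ) :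
    ∑ j ∈ A, Mapply lam (planeLift u) j z * planeLift g j z.swap =
      ∑ p ∈ A ×ˢ B, ∑ q ∈ A ×ˢ B, lam p q * (dlen p)⁻¹ * (dlen q)⁻¹ *
        ((dyadic p).indicator (g q) z.1 * (dyadic q).indicator (u p) z.2) := by
  classical
  have key (i : ℤ) (x : ℝ) (f : ℤ × ℤ → ℝ) (hf : Iat i x ∉ A ×ˢ B → f (Iat i x) = 0)
      (hi : i ∈ A) : ∑ k ∈ B, (if x ∈ dyadic (i, k) then f (i, k) else 0) = f (Iat i x) := by
    simp only [mem_dyadic_iff, Iat, Prod.mk.injEq, true_and, Finset.sum_ite_eq]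
    split_ifs with h
    · rfl
    · exact (hf (by simp [Iat, h])).symm
  have hpow (i j : ℤ) : (2:ℝ) ^ (((i : ℝ) + j) / 2) * 2 ^ ((i : ℝ) / 2) * 2 ^ ((j : ℝ) / 2) =
      2 ^ i * 2 ^ j := by
    rw [← Real.rpow_add two_pos, ← Real.rpow_add two_pos, ← Real.rpow_intCast,
      ← Real.rpow_intCast, ← Real.rpow_add two_pos]
    congr 1
    ring
  have hterm (p q : ℤ × ℤ) : lam p q * (dlen p)⁻¹ * (dlen q)⁻¹ *
        ((dyadic p).indicator (g q) z.1 * (dyadic q).indicator (u p) z.2) =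
      if z.1 ∈ dyadic p then if z.2 ∈ dyadic q then
        lam p q * (2 ^ p.1 * 2 ^ q.1) * (g q z.1 * u p z.2) else 0 else 0 := by
    simp only [Set.indicator_apply, dlen, zpow_neg, inv_inv]
    split_ifs <;> ring
  have hq (p : ℤ × ℤ) : ∑ q ∈ A ×ˢ B, (if z.2 ∈ dyadic q then
        lam p q * (2 ^ p.1 * 2 ^ q.1) * (g q z.1 * u p z.2) else 0) =
      ∑ j ∈ A, lam p (Iat j z.2) * (2 ^ p.1 * 2 ^ j) * (g (Iat j z.2) z.1 * u p z.2) := by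
    rw [Finset.sum_product]
    refine Finset.sum_congr rfl fun j hj => ?_
    exact key j z.2
      (fun q => lam p q * (2 ^ p.1 * 2 ^ q.1) * (g q z.1 * u p z.2))
      (fun h => by simp [hg _ h]) hj
  have hp : ∑ p ∈ A ×ˢ B, (if z.1 ∈ dyadic p then ∑ j ∈ A,
        lam p (Iat j z.2) * (2 ^ p.1 * 2 ^ j) * (g (Iat j z.2) z.1 * u p z.2) else 0) =
      ∑ i ∈ A, ∑ j ∈ A, lam (Iat i z.1) (Iat j z.2) * (2 ^ i * 2 ^ j) *
        (g (Iat j z.2) z.1 * u (Iat i z.1) z.2) := by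
    rw [Finset.sum_product]
    refine Finset.sum_congr rfl fun i hi => ?_
    exact key i z.1 (fun p => ∑ j ∈ A,
      lam p (Iat j z.2) * (2 ^ p.1 * 2 ^ j) * (g (Iat j z.2) z.1 * u p z.2))
      (fun h => by simp [hu _ h]) hi
  have hif (p : ℤ × ℤ) : ∑ q ∈ A ×ˢ B, (if z.1 ∈ dyadic p then if z.2 ∈ dyadic q then
        lam p q * (2 ^ p.1 * 2 ^ q.1) * (g q z.1 * u p z.2) else 0 else 0) =
      if z.1 ∈ dyadic p then ∑ q ∈ A ×ˢ B, (if z.2 ∈ dyadic q then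
        lam p q * (2 ^ p.1 * 2 ^ q.1) * (g q z.1 * u p z.2) else 0) else 0 := by
    split_ifs <;> simp
  simp only [hterm, hif, hq, hp]
  rw [Finset.sum_comm]
  refine Finset.sum_congr rfl fun j _ => ?_
  rw [Mapply_planeLift_eq_sum lam hu, Finset.sum_mul]
  refine Finset.sum_congr rfl fun i _ => ?_
  rw [← hpow]
  simp only [Ment, planeLift, Prod.fst_swap, Prod.snd_swap]
  ring

lemma pairSum_eq_integral (lam : ParaSeq) {A B : Finset ℤ}
    (hu2 : ∀ p, MemLp (u p) 2 volume) (hg2 : ∀ p, MemLp (g p) 2 volume)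
    (hu : ∀ p ∉ A ×ˢ B, u p = 0) (hg : ∀ p ∉ A ×ˢ B, g p = 0) :
    pairSum lam u g =
      ∫ z : ℝ × ℝ, ∑ j ∈ A, Mapply lam (planeLift u) j z * planeLift g j z.swap := by
  have hind_int {f : ℝ → ℝ} (hf : MemLp f 2 volume) (p : ℤ × ℤ) :
      Integrable ((dyadic p).indicator f) := by
    have : IsFiniteMeasure (volume.restrict (dyadic p)) :=
      isFiniteMeasure_restrict.2 (by simp [volume_dyadic])
    exact (integrable_indicator_iff (measurableSet_dyadic p)).2
      ((hf.restrict _).integrable one_le_two)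
  have hterm (p q : ℤ × ℤ) : Integrable fun z : ℝ × ℝ =>
      lam p q * (dlen p)⁻¹ * (dlen q)⁻¹ *
        ((dyadic p).indicator (g q) z.1 * (dyadic q).indicator (u p) z.2) :=
    ((hind_int (hg2 q) p).mul_prod (hind_int (hu2 p) q)).const_mul _
  simp only [sum_Mapply_mul_planeLift lam hu hg]
  rw [integral_finsetSum _ fun p _ => integrable_finsetSum _ fun q _ => hterm p q, pairSum,
    tsum_eq_sum (s := (A ×ˢ B) ×ˢ (A ×ˢ B)), Finset.sum_product]
  · refine Finset.sum_congr rfl fun p _ => ?_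
    rw [integral_finsetSum _ fun q _ => hterm p q]
    refine Finset.sum_congr rfl fun q _ => ?_
    rw [integral_const_mul, Measure.volume_eq_prod, integral_prod_mul,
      integral_indicator (measurableSet_dyadic p), integral_indicator (measurableSet_dyadic q),
      avg, avg]
    ring
  · rintro ⟨p, q⟩ h
    rw [Finset.mem_product, not_and_or] at h
    rcases h with h | h
    · simp [avg, hu p h]
    · simp [avg, hg q h]

end PlaneLift

/-- Cauchy–Schwarz in `ℓ²(L²)`. -/
lemma lintegral_enorm_sum_mul_le {ι α : Type*} [MeasurableSpace α] {μ : Measure α} (A : Finset ι)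
    {F G : ι → α → ℝ} (hF : ∀ i, Measurable (F i)) (hG : ∀ i, Measurable (G i)) :
    ∫⁻ z, ‖∑ i ∈ A, F i z * G i z‖ₑ ∂μ ≤
      (∑' i, ∫⁻ z, ENNReal.ofReal (F i z ^ 2) ∂μ) ^ (1 / 2 : ℝ) *
        (∑' i, ∫⁻ z, ENNReal.ofReal (G i z ^ 2) ∂μ) ^ (1 / 2 : ℝ) := by
  have hsq (x : ℝ) : ENNReal.ofReal (x ^ 2) = ‖x‖ₑ ^ (2 : ℝ) := by
    rw [← sq_abs, ENNReal.ofReal_pow (abs_nonneg x), ← Real.enorm_eq_ofReal_abs]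
    norm_cast
  have hroot (x : ℝ≥0∞) : (x ^ (1 / 2 : ℝ)) ^ (2 : ℝ) = x := by
    rw [← ENNReal.rpow_mul]
    norm_num
  have h2 : Real.HolderConjugate 2 2 := Real.HolderConjugate.two_two
  simp only [hsq]
  calc ∫⁻ z, ‖∑ i ∈ A, F i z * G i z‖ₑ ∂μ
      ≤ ∫⁻ z, ∑ i ∈ A, ‖F i z‖ₑ * ‖G i z‖ₑ ∂μ :=
        lintegral_mono fun z => (enorm_sum_le _ _).trans_eq (by simp only [enorm_mul])
    _ = ∑ i ∈ A, ∫⁻ z, ‖F i z‖ₑ * ‖G i z‖ₑ ∂μ :=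
        lintegral_finsetSum _ fun i _ => (hF i).enorm.mul (hG i).enorm
    _ ≤ ∑ i ∈ A, (∫⁻ z, ‖F i z‖ₑ ^ (2 : ℝ) ∂μ) ^ (1 / 2 : ℝ) *
          (∫⁻ z, ‖G i z‖ₑ ^ (2 : ℝ) ∂μ) ^ (1 / 2 : ℝ) :=
        Finset.sum_le_sum fun i _ => ENNReal.lintegral_mul_le_Lp_mul_Lq μ h2
          (hF i).enorm.aemeasurable (hG i).enorm.aemeasurable
    _ ≤ _ := (ENNReal.inner_le_Lp_mul_Lq A _ _ h2).trans (by
        simp only [hroot]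
        gcongr <;> exact ENNReal.sum_le_tsum A)

/-- Members of an admissible family can be replaced by measurable representatives. -/
lemma Adm.exists_measurable {u : ℤ × ℤ → ℝ → ℝ} (hu : u ∈ Adm) :
    ∃ v : ℤ × ℤ → ℝ → ℝ, (∀ p, Measurable (v p)) ∧ (∀ p, MemLp (v p) 2 volume) ∧
      {p | v p ≠ 0}.Finite ∧ (∀ p, u p =ᵐ[volume] v p) ∧
      ∑' p : ℤ × ℤ, ∫⁻ x, ENNReal.ofReal (v p x ^ 2) = 1 := by
  obtain ⟨hu2, hfin, hsum⟩ := hu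
  have hrep (p : ℤ × ℤ) : ∃ f : ℝ → ℝ, Measurable f ∧ u p =ᵐ[volume] f ∧ (u p = 0 → f = 0) := by
    by_cases h : u p = 0
    · exact ⟨0, measurable_const, by rw [h], fun _ => rfl⟩
    · exact ⟨(hu2 p).1.aemeasurable.mk, AEMeasurable.measurable_mk _, AEMeasurable.ae_eq_mk _,
        fun h0 => absurd h0 h⟩
  choose v hvm hae hv0 using hrep
  refine ⟨v, hvm, fun p => (memLp_congr_ae (hae p)).1 (hu2 p),
    hfin.subset fun p hp h => hp (hv0 p h), hae, ?_⟩
  have hsummable : Summable fun p : ℤ × ℤ => ∫ x, u p x ^ 2 := by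
    by_contra h
    rw [tsum_eq_zero_of_not_summable h] at hsum
    exact zero_ne_one hsum
  rw [← ENNReal.ofReal_one, ← hsum, ENNReal.ofReal_tsum_of_nonneg
    (fun p => integral_nonneg fun x => sq_nonneg _) hsummable]
  refine tsum_congr fun p => ?_
  rw [ofReal_integral_eq_lintegral_ofReal (hu2 p).integrable_sq
    (Filter.Eventually.of_forall fun x => sq_nonneg _)]
  refine lintegral_congr_ae ?_
  filter_upwards [hae p] with x hx
  rw [hx]

/-- `‖λ‖_X ≤ ‖M_λ‖`. -/
theorem Xnorm_le_MopNorm (lam : ParaSeq) : Xnorm lam ≤ MopNorm lam := by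
  classical
  refine iSup_le fun ⟨u₀, hu₀⟩ => iSup_le fun ⟨g₀, hg₀⟩ => ?_
  obtain ⟨u, hum, hu2, hufin, hu_ae, hu1⟩ := Adm.exists_measurable hu₀
  obtain ⟨g, hgm, hg2, hgfin, hg_ae, hg1⟩ := Adm.exists_measurable hg₀
  have hpair : pairSum lam u₀ g₀ = pairSum lam u g :=
    tsum_congr fun pq => by rw [avg_congr (hg_ae pq.2), avg_congr (hu_ae pq.1)]
  let S : Finset (ℤ × ℤ) := hufin.toFinset ∪ hgfin.toFinset
  have hS (p : ℤ × ℤ) (hp : p ∉ S.image Prod.fst ×ˢ S.image Prod.snd) : u p = 0 ∧ g p = 0 := by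
    have : p ∉ S := fun h => hp (Finset.mem_product.2
      ⟨Finset.mem_image_of_mem _ h, Finset.mem_image_of_mem _ h⟩)
    simpa [S] using this
  have hu0 := fun p hp => (hS p hp).1
  have hMm (j : ℤ) : Measurable (Mapply lam (planeLift u) j) := by
    rw [funext fun z => Mapply_planeLift_eq_sum lam hu0 j z]
    exact Finset.measurable_fun_sum _ fun i _ =>
      (measurable_Ment lam i j).mul (measurable_planeLift hum i)
  have hball : planeLift u ∈ Mball :=
    ⟨measurable_planeLift hum, ((tsum_lintegral_planeLift hum).trans hu1).le⟩
  rw [hpair, pairSum_eq_integral lam hu2 hg2 hu0 fun p hp => (hS p hp).2,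
    ← Real.enorm_eq_ofReal_abs]
  refine (enorm_integral_le_lintegral_enorm _).trans <| (lintegral_enorm_sum_mul_le _ hMm
    fun j => (measurable_planeLift hgm j).comp measurable_swap).trans ?_
  simp only [Function.comp_apply]
  rw [tsum_lintegral_planeLift_swap, tsum_lintegral_planeLift hgm, hg1, ENNReal.one_rpow, mul_one]
  exact le_iSup (fun a : Mball =>
    (∑' j : ℤ, ∫⁻ z : ℝ × ℝ, ENNReal.ofReal ((Mapply lam a.1 j z) ^ 2)) ^ (1/2 : ℝ))
    ⟨planeLift u, hball⟩

end
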